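/- Let t, k, ℓ, n be integers with k < n < 2^k, ℓ ≥ 1, and ℓ + 1 ≤ t ≤ n·2^ℓ − k. Then there exists a (2^k, 2^t; n, 2^ℓ)-de Bruijn array code of size 2^{n·2^ℓ − k − t}. -/

import Mathlib

/-- `C` is an `(r, s; n, m)`-de Bruijn array code of size `Δ`: every `n × m` binary
matrix appears exactly once as a window in exactly one codeword. -/
def IsDBAC (r s n m Δ : ℕ) (C : Fin Δ → (ZMod r × ZMod s → ZMod 2)) : Prop :=
  ∀ M : Fin n → Fin m → ZMod 2,
    ∃! p : Fin Δ × ZMod r × ZMod s,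
      ∀ (x : Fin n) (y : Fin m),
        C p.1 (p.2.1 + (x : ℕ), p.2.2 + (y : ℕ)) = M x y

/-- The weight of the `j`-th column of a doubly-periodic array `A`. -/
noncomputable def colWeight {r s : ℕ} (A : ZMod r × ZMod s → ZMod 2) (j : ZMod s) : ℕ :=
  {i : ZMod r | A (i, j) = 1}.ncard

namespace DBAC

abbrev Sq := ℕ → ZMod 2

def E (s : Sq) : Sq := fun i => s (i + 1)
def D (s : Sq) : Sq := fun i => s (i + 1) + s i
def S (n : ℕ) : Set Sq := {s | D^[n] s = 1}

lemma z2 (x : ZMod 2) : x + x = 0 := by revert x; decide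

lemma z2ne {x y : ZMod 2} (h : x ≠ y) : x = y + 1 := by revert x y; decide

lemma E_iter (s : Sq) (j i : ℕ) : E^[j] s i = s (i + j) := by
  induction j generalizing s with
  | zero => rfl
  | succ j ih => rw [Function.iterate_succ_apply, ih]; rfl

lemma DE (s : Sq) : D (E s) = E (D s) := rfl

lemma comm_DE : Function.Commute D E := fun s => DE s

lemma E_one : E 1 = 1 := rfl

lemma E_mem {n : ℕ} {s : Sq} (h : s ∈ S n) : E s ∈ S n := by
  have := (comm_DE.iterate_left n) s
  have h : D^[n] s = 1 := h
  change D^[n] (E s) = 1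
  rw [this, h, E_one]

lemma Ei_mem {n : ℕ} {s : Sq} (h : s ∈ S n) (j : ℕ) : E^[j] s ∈ S n := by
  induction j with
  | zero => exact h
  | succ j ih => rw [Function.iterate_succ_apply']; exact E_mem ih

lemma D_one : D 1 = 0 := by funext i; exact z2 1

lemma D_zero : D 0 = 0 := by funext i; exact z2 0

lemma D_zero_iter (j : ℕ) : D^[j] 0 = 0 := Function.iterate_fixed D_zero j

lemma D_pow (a : ℕ) (s : Sq) (i : ℕ) : D^[2 ^ a] s i = s (i + 2 ^ a) + s i := by
  induction a generalizing s i with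
  | zero => rfl
  | succ a ih =>
    have : 2 ^ (a + 1) = 2 ^ a + 2 ^ a := by ring
    rw [this, Function.iterate_add_apply, ih, ih, ih]
    have h := z2 (s (i + 2 ^ a))
    rw [← add_assoc i]
    linear_combination h

lemma period {n a : ℕ} {s : Sq} (h : s ∈ S n) (hn : n < 2 ^ a) : E^[2 ^ a] s = s := by
  have h1 : D^[2 ^ a] s = 0 := by
    obtain ⟨d, hd⟩ : ∃ d, 2 ^ a = d + 1 + n := ⟨2 ^ a - n - 1, by omega⟩
    have h : D^[n] s = 1 := h
    rw [hd, Function.iterate_add_apply, h, Function.iterate_succ_apply, D_one, D_zero_iter]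
  funext i
  rw [E_iter]
  have := congrFun h1 i
  rw [D_pow] at this
  by_contra hne
  rw [z2ne hne] at this
  have h2 := z2 (s i)
  have : (1 : ZMod 2) = 0 := by
    have : s i + 1 + s i = 0 := this
    linear_combination this - h2
  exact absurd this (by decide)

lemma not_period {n a : ℕ} {s : Sq} (h : s ∈ S n) (hn : 2 ^ a ≤ n) : E^[2 ^ a] s ≠ s := by
  intro hp
  have h1 : D^[2 ^ a] s = 0 := by
    funext i
    rw [D_pow, ← E_iter s, hp]; exact z2 _
  obtain ⟨d, hd⟩ : ∃ d, n = d + 2 ^ a := ⟨n - 2 ^ a, by omega⟩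
  have h : D^[n] s = 1 := h
  rw [hd, Function.iterate_add_apply, h1, D_zero_iter] at h
  exact absurd (congrFun h 0) (by decide)

lemma minPer {n a : ℕ} {s : Sq} (h : s ∈ S n) (hn : 2 ^ a ≤ n) (hn' : n < 2 ^ (a + 1)) :
    Function.minimalPeriod E s = 2 ^ (a + 1) :=
  Function.minimalPeriod_eq_prime_pow (not_period h hn) (period h hn')

/-- integration -/
def I (v : Sq) (c : ZMod 2) : Sq
  | 0 => c
  | i + 1 => I v c i + v i

lemma D_I (v : Sq) (c : ZMod 2) : D (I v c) = v := by
  funext i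
  change I v c i + v i + I v c i = v i
  linear_combination z2 (I v c i)

lemma D_inj_pref {n : ℕ} {x y : Sq} (h0 : x 0 = y 0) (h : ∀ i, i < n → D x i = D y i) :
    ∀ i, i < n + 1 → x i = y i := by
  intro i
  induction i with
  | zero => intro _; exact h0
  | succ i ih =>
    intro hi
    have h1 := ih (by omega)
    have h2 : x (i + 1) + x i = y (i + 1) + y i := h i (by omega)
    rw [h1] at h2
    exact add_right_cancel h2

lemma D_inj {x y : Sq} (h0 : x 0 = y 0) (h : D x = D y) : x = y := by
  funext i
  exact D_inj_pref (n := i) h0 (fun j _ => congrFun h j) i (by omega)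

lemma D_add_one (x : Sq) : D (x + 1) = D x := by
  funext i
  change x (i + 1) + 1 + (x i + 1) = x (i + 1) + x i
  linear_combination z2 1

lemma D_eq {x y : Sq} (h : D x = D y) : x = y ∨ x = y + 1 := by
  by_cases h0 : x 0 = y 0
  · exact Or.inl (D_inj h0 h)
  · exact Or.inr (D_inj (z2ne h0) (by rw [D_add_one, h]))

lemma ne_add_one (x : Sq) : x ≠ x + 1 := by
  intro h
  have h := congrFun h 0
  have h' : x 0 = x 0 + 1 := h
  revert h'; generalize x 0 = z; revert z; decide

lemma add_one_add_one (x : Sq) : x + 1 + 1 = x := by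
  funext i
  change x i + 1 + 1 = x i
  linear_combination z2 1

lemma mem_succ {n : ℕ} {x : Sq} : x ∈ S (n + 1) ↔ D x ∈ S n := Iff.rfl

lemma pref_inj {n : ℕ} {x y : Sq} (hx : x ∈ S n) (hy : y ∈ S n) (h : ∀ i, i < n → x i = y i) :
    x = y := by
  induction n generalizing x y with
  | zero =>
    have hx : x = 1 := hx
    have hy : y = 1 := hy
    rw [hx, hy]
  | succ n ih =>
    refine D_inj (h 0 (by omega)) (ih (mem_succ.1 hx) (mem_succ.1 hy) ?_)
    intro i hi
    change x (i + 1) + x i = y (i + 1) + y i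
    rw [h i (by omega), h (i + 1) (by omega)]

lemma pref_ex (n : ℕ) (w : Sq) : ∃ x ∈ S n, ∀ i, i < n → x i = w i := by
  induction n generalizing w with
  | zero => exact ⟨1, rfl, by omega⟩
  | succ n ih =>
    obtain ⟨v, hv, h⟩ := ih (D w)
    refine ⟨I v (w 0), ?_, D_inj_pref rfl ?_⟩
    · rw [mem_succ, D_I]; exact hv
    · intro i hi
      rw [D_I]; exact h i hi

lemma closed_all {n : ℕ} {P : Set Sq} (hne : P.Nonempty) (hS : P ⊆ S n)
    (hE : ∀ x ∈ P, E x ∈ P)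
    (hadj : ∀ x ∈ P, ∀ y ∈ S n, (∀ i, i + 1 < n → x i = y i) → y ∈ P) :
    S n ⊆ P := by
  intro y hy
  have key : ∀ j, j ≤ n → ∃ z ∈ P, ∀ i, i < j → z (n - j + i) = y i := by
    intro j
    induction j with
    | zero =>
      intro _
      obtain ⟨x, hx⟩ := hne
      exact ⟨x, hx, by omega⟩
    | succ j ih =>
      intro hj
      obtain ⟨z, hz, h⟩ := ih (by omega)
      obtain ⟨z', hz', h'⟩ := pref_ex n (fun i => if i + 1 < n then E z i else y j)
      refine ⟨z', hadj (E z) (hE z hz) z' hz' ?_, ?_⟩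
      · intro i hi
        rw [h' i (by omega), if_pos hi]
      · intro i hi
        rw [h' _ (by omega)]
        by_cases hij : i < j
        · rw [if_pos (by omega), ← h i hij]
          change z _ = _
          congr 1
          omega
        · rw [if_neg (by omega)]
          congr 1; omega
  obtain ⟨z, hz, h⟩ := key n le_rfl
  have : z = y := pref_inj (hS hz) hy (fun i hi => by simpa using h i hi)
  exact this ▸ hz

def orb (s : Sq) : Set Sq := {x | ∃ j, x = E^[j] s}

inductive Good (n : ℕ) : ℕ → Set Sq → Prop
  | orb (s : Sq) (hs : s ∈ S n) : Good n 1 (orb s)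
  | merge (c d : ℕ) (P Q : Set Sq) (hP : Good n c P) (hQ : Good n d Q) (hd : Disjoint P Q)
      (x y : Sq) (hx : x ∈ P) (hy : y ∈ Q) (h : ∀ i, i + 1 < n → x i = y i) :
      Good n (c + d) (P ∪ Q)

lemma Good.sub {n c : ℕ} {P : Set Sq} (h : Good n c P) : P ⊆ S n := by
  induction h with
  | orb s hs => rintro _ ⟨j, rfl⟩; exact Ei_mem hs j
  | merge c d P Q hP hQ hd x y hx hy h ih1 ih2 => exact Set.union_subset ih1 ih2

lemma Good.E {n c : ℕ} {P : Set Sq} (h : Good n c P) : ∀ x ∈ P, E x ∈ P := by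
  induction h with
  | orb s hs =>
    rintro _ ⟨j, rfl⟩
    exact ⟨j + 1, by rw [Function.iterate_succ_apply']⟩
  | merge c d P Q hP hQ hd x y hx hy h ih1 ih2 =>
    rintro z (hz | hz)
    · exact Or.inl (ih1 z hz)
    · exact Or.inr (ih2 z hz)

lemma Good.ne {n c : ℕ} {P : Set Sq} (h : Good n c P) : P.Nonempty := by
  induction h with
  | orb s hs => exact ⟨s, 0, rfl⟩
  | merge c d P Q hP hQ hd x y hx hy h ih1 ih2 => exact ⟨x, Or.inl hx⟩

lemma D_Ei (s : Sq) (j : ℕ) : D (E^[j] s) = E^[j] (D s) := (comm_DE.iterate_right j) s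

lemma Ei_add_one (s : Sq) (j : ℕ) : E^[j] (s + 1) = E^[j] s + 1 := by
  funext i
  rw [E_iter]
  change s (i + j) + 1 = E^[j] s i + 1
  rw [E_iter]

lemma lift_normal {n a c : ℕ} {P : Set Sq} (ha : 2 ^ a ≤ n) (ha' : n + 1 < 2 ^ (a + 1))
    (h : Good n c P) : ∃ P1 P2, Good (n + 1) c P1 ∧ Good (n + 1) c P2 ∧ Disjoint P1 P2 ∧
      P1 ∪ P2 = D ⁻¹' P ∧ (∀ x ∈ P1, x + 1 ∈ P2) ∧ (∀ x ∈ P2, x + 1 ∈ P1) := by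
  induction h with
  | orb s hs =>
    have hm : I s 0 ∈ S (n + 1) := by rw [mem_succ, D_I]; exact hs
    have hm' : I s 0 + 1 ∈ S (n + 1) := by rw [mem_succ, D_add_one, D_I]; exact hs
    refine ⟨DBAC.orb (I s 0), DBAC.orb (I s 0 + 1), Good.orb _ hm, Good.orb _ hm', ?_, ?_, ?_, ?_⟩
    · rw [Set.disjoint_left]
      rintro x ⟨i, hi⟩ ⟨j, hj⟩
      rw [Ei_add_one] at hj
      have h1 : E^[i] s = E^[j] s := by
        have h1 := congrArg D hi
        have h2 := congrArg D hj
        rw [D_add_one, D_Ei, D_I] at h2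
        rw [D_Ei, D_I] at h1
        exact h1.symm.trans h2
      have h2 : E^[i] (I s 0) = E^[j] (I s 0) := by
        have hp : Function.minimalPeriod E s = Function.minimalPeriod E (I s 0) := by
          rw [minPer hs ha (by omega), minPer hm (by omega) ha']
        have e1 : ∀ s : Sq, E^[i % Function.minimalPeriod E s] s = E^[i] s :=
          fun s => Function.iterate_mod_minimalPeriod_eq
        have e2 : ∀ s : Sq, E^[j % Function.minimalPeriod E s] s = E^[j] s :=
          fun s => Function.iterate_mod_minimalPeriod_eq
        have hpos : 0 < Function.minimalPeriod E s := by
          rw [minPer hs ha (by omega)]; positivity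
        have : i % Function.minimalPeriod E s = j % Function.minimalPeriod E s := by
          apply Function.iterate_injOn_Iio_minimalPeriod (f := E) (x := s)
          · exact Nat.mod_lt _ hpos
          · exact Nat.mod_lt _ hpos
          · change E^[_] s = E^[_] s
            rw [e1, e2, h1]
        rw [← e1, ← e2, ← hp, this]
      rw [← h2, ← hi] at hj
      exact ne_add_one x hj
    · ext x
      constructor
      · rintro (⟨j, rfl⟩ | ⟨j, rfl⟩)
        · exact ⟨j, by rw [D_Ei, D_I]⟩
        · exact ⟨j, by rw [D_Ei, D_add_one, D_I]⟩
      · rintro ⟨j, hj⟩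
        have : D x = D (E^[j] (I s 0)) := by rw [hj, D_Ei, D_I]
        rcases D_eq this with h | h
        · exact Or.inl ⟨j, h⟩
        · exact Or.inr ⟨j, by rw [Ei_add_one, h]⟩
    · rintro x ⟨j, rfl⟩
      exact ⟨j, by rw [Ei_add_one]⟩
    · rintro x ⟨j, rfl⟩
      exact ⟨j, by rw [Ei_add_one, add_one_add_one]⟩
  | merge c d P Q hP hQ hd x y hx hy h ih1 ih2 =>
    obtain ⟨P1, P2, gP1, gP2, dP, uP, sP1, sP2⟩ := ih1
    obtain ⟨Q1, Q2, gQ1, gQ2, dQ, uQ, sQ1, sQ2⟩ := ih2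
    have lx : ∃ x1 ∈ P1, D x1 = x := by
      have : I x 0 ∈ P1 ∪ P2 := by rw [uP]; rw [Set.mem_preimage, D_I]; exact hx
      rcases this with h | h
      · exact ⟨_, h, D_I _ _⟩
      · exact ⟨_, sP2 _ h, by rw [D_add_one, D_I]⟩
    have ly : ∃ y1 ∈ Q1, D y1 = y := by
      have : I y 0 ∈ Q1 ∪ Q2 := by rw [uQ]; rw [Set.mem_preimage, D_I]; exact hy
      rcases this with h | h
      · exact ⟨_, h, D_I _ _⟩
      · exact ⟨_, sQ2 _ h, by rw [D_add_one, D_I]⟩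
    obtain ⟨x1, hx1, ex⟩ := lx
    obtain ⟨y1, hy1, ey⟩ := ly
    have dPQ : Disjoint (P1 ∪ P2) (Q1 ∪ Q2) := by
      rw [uP, uQ]; exact Disjoint.preimage D hd
    -- general step with the right matching
    have step : ∀ R1 R2 : Set Sq, Good (n + 1) d R1 → Good (n + 1) d R2 → Disjoint R1 R2 →
        R1 ∪ R2 = D ⁻¹' Q → (∀ x ∈ R1, x + 1 ∈ R2) → (∀ x ∈ R2, x + 1 ∈ R1) →
        ∀ z ∈ R1, D z = y → x1 0 = z 0 →
        ∃ P1 P2, Good (n + 1) (c + d) P1 ∧ Good (n + 1) (c + d) P2 ∧ Disjoint P1 P2 ∧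
      P1 ∪ P2 = D ⁻¹' (P ∪ Q) ∧ (∀ x ∈ P1, x + 1 ∈ P2) ∧ (∀ x ∈ P2, x + 1 ∈ P1) := by
      intro R1 R2 g1 g2 dR uR s1 s2 z hz ez h0
      have dPR : Disjoint (P1 ∪ P2) (R1 ∪ R2) := by rw [uR, ← uQ]; exact dPQ
      have agree : ∀ i, i + 1 < n + 1 → x1 i = z i := by
        intro i hi
        refine D_inj_pref (n := n - 1) h0 ?_ i (by omega)
        intro i hi
        rw [ex, ez]; exact h i (by omega)
      have dd := dPR
      simp only [Set.disjoint_union_left, Set.disjoint_union_right] at dd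
      obtain ⟨⟨d11, d21⟩, d12, d22⟩ := dd
      refine ⟨P1 ∪ R1, P2 ∪ R2, Good.merge c d P1 R1 gP1 g1 (by assumption) x1 z hx1 hz agree,
        Good.merge c d P2 R2 gP2 g2 (by assumption) (x1 + 1) (z + 1) (sP1 _ hx1) (s1 _ hz) ?_, ?_, ?_, ?_, ?_⟩
      · intro i hi
        change x1 i + 1 = z i + 1
        rw [agree i hi]
      · simp only [Set.disjoint_union_left, Set.disjoint_union_right]
        refine ⟨⟨dP, ?_⟩, ?_, dR⟩
        · exact Disjoint.symm (by assumption)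
        · assumption
      · rw [Set.preimage_union, ← uP, ← uR]
        ext w; simp only [Set.mem_union]; tauto
      · rintro w (hw | hw)
        · exact Or.inl (sP1 w hw)
        · exact Or.inr (s1 w hw)
      · rintro w (hw | hw)
        · exact Or.inl (sP2 w hw)
        · exact Or.inr (s2 w hw)
    by_cases h0 : x1 0 = y1 0
    · exact step Q1 Q2 gQ1 gQ2 dQ uQ sQ1 sQ2 y1 hy1 ey h0
    · exact step Q2 Q1 gQ2 gQ1 dQ.symm (by rw [Set.union_comm, uQ]) sQ2 sQ1 (y1 + 1) (sQ1 _ hy1)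
        (by rw [D_add_one, ey]) (z2ne h0)

lemma lift_jump {n a c : ℕ} {P : Set Sq} (ha' : n + 1 = 2 ^ (a + 1))
    (h : Good n c P) : Good (n + 1) c (D ⁻¹' P) := by
  induction h with
  | orb s hs =>
    have hm : I s 0 ∈ S (n + 1) := by rw [mem_succ, D_I]; exact hs
    have : D ⁻¹' (DBAC.orb s) = DBAC.orb (I s 0) := by
      ext x
      constructor
      · rintro ⟨j, hj⟩
        have : D x = D (E^[j] (I s 0)) := by rw [hj, D_Ei, D_I]
        rcases D_eq this with h | h
        · exact ⟨j, h⟩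
        · refine ⟨j + 2 ^ (a + 1), ?_⟩
          rw [Function.iterate_add_apply, h, ← Ei_add_one]
          congr 1
          funext i
          rw [E_iter]
          have h1 : D^[n + 1] (I s 0) = 1 := hm
          rw [ha'] at h1
          have h2 := congrFun h1 i
          rw [D_pow] at h2
          have h2 : I s 0 (i + 2 ^ (a + 1)) + I s 0 i = 1 := h2
          change I s 0 i + 1 = _
          linear_combination z2 (I s 0 i) - h2
      · rintro ⟨j, rfl⟩
        exact ⟨j, by rw [D_Ei, D_I]⟩
    rw [this]
    exact Good.orb _ hm
  | merge c d P Q hP hQ hd x y hx hy h ih1 ih2 =>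
    rw [Set.preimage_union]
    refine Good.merge c d _ _ ih1 ih2 (Disjoint.preimage D hd) (I x 0) (I y 0) ?_ ?_ ?_
    · rw [Set.mem_preimage, D_I]; exact hx
    · rw [Set.mem_preimage, D_I]; exact hy
    · intro i hi
      refine D_inj_pref (n := n - 1) (x := I x 0) (y := I y 0) rfl ?_ i (by omega)
      intro i hi
      rw [D_I, D_I]; exact h i (by omega)

def Part (n c : ℕ) : Prop := ∃ (ι : Type) (P : ι → Set Sq), (∀ i, Good n c (P i)) ∧
  (∀ i j x, x ∈ P i → x ∈ P j → i = j) ∧ (∀ x ∈ S n, ∃ i, x ∈ P i)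

lemma part_orb {n a : ℕ} (hn' : n < 2 ^ (a + 1)) : Part n 1 := by
  have hrev : ∀ s ∈ S n, ∀ x ∈ orb s, orb x = orb s := by
    rintro s hs _ ⟨j, rfl⟩
    ext y
    constructor
    · rintro ⟨i, rfl⟩
      exact ⟨i + j, by rw [Function.iterate_add_apply]⟩
    · rintro ⟨i, rfl⟩
      refine ⟨i + (2 ^ (a + 1) - 1) * j, ?_⟩
      have h1 : E^[2 ^ (a + 1) * j] s = s := by
        rw [Function.iterate_mul]
        exact Function.iterate_fixed (period hs hn') j
      rw [← Function.iterate_add_apply]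
      have : i + (2 ^ (a + 1) - 1) * j + j = i + 2 ^ (a + 1) * j := by
        have : 1 ≤ 2 ^ (a + 1) := Nat.one_le_two_pow
        obtain ⟨b, hb⟩ := Nat.exists_eq_add_of_le this
        rw [hb]; simp; ring
      rw [this, Function.iterate_add_apply, h1]
  refine ⟨{P : Set Sq // ∃ s ∈ S n, P = orb s}, fun P => P.1, ?_, ?_, ?_⟩
  · rintro ⟨_, s, hs, rfl⟩
    exact Good.orb s hs
  · rintro ⟨_, s, hs, rfl⟩ ⟨_, t, ht, rfl⟩ x hx hx'
    apply Subtype.ext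
    change orb s = orb t
    rw [← hrev s hs x hx, ← hrev t ht x hx']
  · intro x hx
    exact ⟨⟨orb x, x, hx, rfl⟩, 0, rfl⟩

lemma part_normal {n a c : ℕ} (ha : 2 ^ a ≤ n) (ha' : n + 1 < 2 ^ (a + 1)) (h : Part n c) :
    Part (n + 1) c := by
  obtain ⟨ι, P, hg, hd, hc⟩ := h
  choose P1 P2 g1 g2 dd uu s1 s2 using fun i => lift_normal ha ha' (hg i)
  refine ⟨ι × Bool, fun i => if i.2 then P1 i.1 else P2 i.1, ?_, ?_, ?_⟩
  · rintro ⟨i, b⟩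
    cases b
    · exact g2 i
    · exact g1 i
  · have hin : ∀ i b x, x ∈ (if b = true then P1 i else P2 i) → D x ∈ P i := by
      intro i b x hx
      change x ∈ D ⁻¹' P i
      rw [← uu]
      cases b
      · exact Or.inr hx
      · exact Or.inl hx
    rintro ⟨i, b⟩ ⟨j, b'⟩ x hx hx'
    have : i = j := hd i j (D x) (hin i b x hx) (hin j b' x hx')
    subst this
    have h : x ∈ P1 i → x ∉ P2 i := fun h => Set.disjoint_left.1 (dd i) h
    cases b <;> cases b'
    · rfl
    · exact absurd hx (h hx')
    · exact absurd hx' (h hx)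
    · rfl
  · intro x hx
    obtain ⟨i, hi⟩ := hc (D x) hx
    have : x ∈ P1 i ∪ P2 i := by rw [uu]; exact hi
    rcases this with h | h
    · exact ⟨(i, true), h⟩
    · exact ⟨(i, false), h⟩

lemma part_jump {n a c : ℕ} (ha' : n + 1 = 2 ^ (a + 1)) (h : Part n c) :
    Part (n + 1) c := by
  obtain ⟨ι, P, hg, hd, hc⟩ := h
  exact ⟨ι, fun i => D ⁻¹' P i, fun i => lift_jump ha' (hg i),
    fun i j x hx hx' => hd i j (D x) hx hx', fun x hx => hc (D x) hx⟩

lemma top_normal {n a c : ℕ} (ha : 2 ^ a ≤ n) (ha' : n + 1 < 2 ^ (a + 1)) (h : Good n c (S n)) :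
    Good (n + 1) (c + c) (S (n + 1)) := by
  obtain ⟨P1, P2, g1, g2, dd, uu, s1, s2⟩ := lift_normal ha ha' h
  have uu : P1 ∪ P2 = S (n + 1) := uu
  rw [← uu]
  by_contra hcon
  have : S (n + 1) ⊆ P1 := by
    refine closed_all g1.ne g1.sub g1.E ?_
    intro x hx y hy hxy
    rw [← uu] at hy
    rcases hy with hy | hy
    · exact hy
    · exact absurd (Good.merge c c P1 P2 g1 g2 dd x y hx hy hxy) hcon
  obtain ⟨z, hz⟩ := g2.ne
  exact Set.disjoint_left.1 dd (this (g2.sub hz)) hz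

lemma main_part (n : ℕ) (hn : 1 ≤ n) : ∀ a, 2 ^ a ≤ n → n < 2 ^ (a + 1) →
    (∀ j, j + (a + 1) ≤ n → Part n (2 ^ j)) ∧ Good n (2 ^ (n - (a + 1))) (S n) := by
  induction n, hn using Nat.le_induction with
  | base =>
    intro a h1 h2
    have ha : a = 0 := by
      by_contra h
      have := Nat.pow_le_pow_right (n := 2) (by omega) (Nat.one_le_iff_ne_zero.2 h)
      omega
    subst ha
    refine ⟨fun j hj => ?_, ?_⟩
    · obtain rfl : j = 0 := by omega
      exact part_orb (a := 0) (by norm_num)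
    · obtain ⟨s, hs, h⟩ := pref_ex 1 0
      have : orb s = S 1 := by
        apply Set.Subset.antisymm
        · rintro _ ⟨j, rfl⟩; exact Ei_mem hs j
        · intro x hx
          have hx' : D x = D s := by
            have h1 : D x = 1 := hx
            have h2 : D s = 1 := hs
            rw [h1, h2]
          rcases D_eq hx' with h | h
          · exact ⟨0, h⟩
          · refine ⟨1, ?_⟩
            rw [h]
            funext i
            have h2 : D s = 1 := hs
            have h2 : s (i + 1) + s i = 1 := congrFun h2 i
            change s i + 1 = s (i + 1)
            linear_combination z2 (s i) - h2
      rw [← this]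
      exact Good.orb s hs
  | succ n hn ih =>
    intro a h1 h2
    by_cases hj : n + 1 = 2 ^ a
    · -- jump
      obtain ⟨b, rfl⟩ : ∃ b, a = b + 1 := by
        cases a with
        | zero => simp at hj; omega
        | succ b => exact ⟨b, rfl⟩
      have hb : 2 ^ b ≤ n := by
        have : 2 ^ (b + 1) = 2 * 2 ^ b := by ring
        omega
      obtain ⟨i1, i2⟩ := ih b hb (by omega)
      refine ⟨fun j hjj => part_jump hj (i1 j (by omega)), ?_⟩
      have := lift_jump hj i2
      have e : n + 1 - (b + 1 + 1) = n - (b + 1) := by omega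
      rw [e]
      exact this
    · have hlt : 2 ^ a ≤ n := by omega
      obtain ⟨i1, i2⟩ := ih a hlt (by omega)
      have ha : a < 2 ^ a := Nat.lt_two_pow_self
      have top : Good (n + 1) (2 ^ (n + 1 - (a + 1))) (S (n + 1)) := by
        have := top_normal hlt h2 i2
        have e : n + 1 - (a + 1) = n - (a + 1) + 1 := by omega
        rw [e, pow_succ, mul_two]
        exact this
      refine ⟨fun j hjj => ?_, top⟩
      by_cases hjn : j + (a + 1) ≤ n
      · exact part_normal hlt h2 (i1 j hjn)
      · obtain rfl : j = n + 1 - (a + 1) := by omega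
        exact ⟨Unit, fun _ => S (n + 1), fun _ => top, fun _ _ _ _ _ => rfl, fun x hx => ⟨(), hx⟩⟩

def Trail (n L : ℕ) (P : Set Sq) : Prop := ∃ f : ℕ → Sq, (∀ i, f (i + L) = f i) ∧
  (∀ i j, i < L → j < L → f i = f j → i = j) ∧ (∀ x, x ∈ P ↔ ∃ i < L, f i = x) ∧
  (∀ i x, x + 1 < n → f i (x + 1) = f (i + 1) x)

lemma per_mod {α : Type*} {f : ℕ → α} {L : ℕ} (h : ∀ i, f (i + L) = f i) (i : ℕ) :
    f (i % L) = f i := by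
  exact Function.Periodic.map_mod_nat h i

/-- rotate a trail to start at a given element -/
lemma Trail.start {n L : ℕ} {P : Set Sq} (h : Trail n L P) {x : Sq} (hx : x ∈ P) :
    ∃ f : ℕ → Sq, (∀ i, f (i + L) = f i) ∧
  (∀ i j, i < L → j < L → f i = f j → i = j) ∧ (∀ x, x ∈ P ↔ ∃ i < L, f i = x) ∧
  (∀ i x, x + 1 < n → f i (x + 1) = f (i + 1) x) ∧ f 0 = x := by
  obtain ⟨f, h1, h2, h3, h4⟩ := h
  obtain ⟨i0, hi0, rfl⟩ := (h3 x).1 hx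
  have hL : 0 < L := by omega
  refine ⟨fun i => f (i0 + i), ?_, ?_, ?_, ?_, rfl⟩
  · intro i; change f (i0 + (i + L)) = _; rw [← add_assoc, h1]
  · intro i j hi hj hij
    have hij : f (i0 + i) = f (i0 + j) := hij
    rw [← per_mod h1 (i0 + i), ← per_mod h1 (i0 + j)] at hij
    have := h2 _ _ (Nat.mod_lt _ hL) (Nat.mod_lt _ hL) hij
    have h5 : i ≡ j [MOD L] := Nat.ModEq.add_left_cancel' i0 this
    rwa [Nat.ModEq, Nat.mod_eq_of_lt hi, Nat.mod_eq_of_lt hj] at h5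
  · intro x
    rw [h3]
    constructor
    · rintro ⟨i, hi, rfl⟩
      by_cases hc : i0 ≤ i
      · exact ⟨i - i0, by omega, by change f (i0 + (i - i0)) = _; congr 1; omega⟩
      · refine ⟨i + L - i0, by omega, ?_⟩
        change f (i0 + (i + L - i0)) = _
        rw [← h1 i]; congr 1; omega
    · rintro ⟨i, hi, rfl⟩
      exact ⟨(i0 + i) % L, Nat.mod_lt _ hL, per_mod h1 _⟩
  · intro i x hx
    exact h4 (i0 + i) x hx

lemma Good.trail {n a c : ℕ} {P : Set Sq} (ha : 2 ^ a ≤ n) (ha' : n < 2 ^ (a + 1))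
    (h : Good n c P) : Trail n (c * 2 ^ (a + 1)) P := by
  induction h with
  | orb s hs =>
    rw [one_mul]
    have hp := minPer hs ha ha'
    have hper : ∀ i, DBAC.E^[i + 2 ^ (a + 1)] s = DBAC.E^[i] s := by
      intro i; rw [Function.iterate_add_apply, period hs ha']
    refine ⟨fun i => DBAC.E^[i] s, hper, ?_, ?_, ?_⟩
    · intro i j hi hj hij
      apply Function.iterate_injOn_Iio_minimalPeriod (f := DBAC.E) (x := s)
      · rw [hp]; exact hi
      · rw [hp]; exact hj
      · exact hij
    · intro x
      constructor
      · rintro ⟨j, rfl⟩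
        exact ⟨j % 2 ^ (a + 1), Nat.mod_lt _ (by positivity), per_mod (f := fun i => DBAC.E^[i] s) hper j⟩
      · rintro ⟨j, _, rfl⟩
        exact ⟨j, rfl⟩
    · intro i x _
      change DBAC.E^[i] s (x + 1) = DBAC.E^[i + 1] s x
      rw [E_iter, E_iter]; congr 1; ring
  | merge c d P Q hP hQ hd x y hx hy h ih1 ih2 =>
    obtain ⟨f, f1, f2, f3, f4, f0⟩ := ih1.start hx
    obtain ⟨g, g1, g2, g3, g4, g0⟩ := ih2.start hy
    rw [add_mul]
    have hLp : 0 < c * 2 ^ (a + 1) := by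
      obtain ⟨i, hi, _⟩ := (f3 x).1 hx; omega
    have hMp : 0 < d * 2 ^ (a + 1) := by
      obtain ⟨i, hi, _⟩ := (g3 y).1 hy; omega
    generalize c * 2 ^ (a + 1) = L at *
    generalize d * 2 ^ (a + 1) = M at *
    let u : ℕ → Sq := fun r => if r < L then f r else g (r - L)
    have uL : ∀ r, r < L → u r = f r := fun r hr => if_pos hr
    have uM : ∀ r, ¬ r < L → u r = g (r - L) := fun r hr => if_neg hr
    have fP : ∀ r, r < L → f r ∈ P := fun r hr => (f3 _).2 ⟨r, hr, rfl⟩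
    have gQ : ∀ r, r < M → g r ∈ Q := fun r hr => (g3 _).2 ⟨r, hr, rfl⟩
    have hdd := Set.disjoint_left.1 hd
    refine ⟨fun i => u (i % (L + M)), ?_, ?_, ?_, ?_⟩
    · intro i; simp
    · intro i j hi hj hij
      simp only [Nat.mod_eq_of_lt hi, Nat.mod_eq_of_lt hj] at hij
      by_cases hi' : i < L <;> by_cases hj' : j < L
      · rw [uL i hi', uL j hj'] at hij; exact f2 i j hi' hj' hij
      · rw [uL i hi', uM j hj'] at hij
        exact absurd (gQ (j - L) (by omega)) (hij ▸ hdd (fP i hi'))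
      · rw [uM i hi', uL j hj'] at hij
        exact absurd (gQ (i - L) (by omega)) (hij ▸ hdd (fP j hj'))
      · rw [uM i hi', uM j hj'] at hij
        have := g2 _ _ (by omega) (by omega) hij
        omega
    · intro z
      constructor
      · rintro (hz | hz)
        · obtain ⟨i, hi, rfl⟩ := (f3 z).1 hz
          refine ⟨i, by omega, ?_⟩
          change u (i % (L + M)) = _
          rw [Nat.mod_eq_of_lt (by omega), uL i hi]
        · obtain ⟨i, hi, rfl⟩ := (g3 z).1 hz
          refine ⟨L + i, by omega, ?_⟩
          change u ((L + i) % (L + M)) = _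
          rw [Nat.mod_eq_of_lt (by omega), uM _ (by omega)]
          congr 1; omega
      · rintro ⟨i, hi, rfl⟩
        change u (i % (L + M)) ∈ _
        rw [Nat.mod_eq_of_lt hi]
        by_cases hi' : i < L
        · rw [uL i hi']; exact Or.inl (fP i hi')
        · rw [uM i hi']; exact Or.inr (gQ _ (by omega))
    · intro i z hz
      change u (i % (L + M)) (z + 1) = u ((i + 1) % (L + M)) z
      rw [Nat.add_mod i 1, Nat.mod_eq_of_lt (show 1 < L + M by omega)]
      have hr : i % (L + M) < L + M := Nat.mod_lt _ (by omega)
      generalize i % (L + M) = r at hr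
      have fL : f L = x := by rw [← f0, ← f1 0, zero_add]
      have gM : g M = y := by rw [← g0, ← g1 0, zero_add]
      by_cases c1 : r + 1 < L
      · rw [Nat.mod_eq_of_lt (by omega), uL _ c1, uL _ (by omega)]; exact f4 r z hz
      · by_cases c2 : r + 1 = L
        · rw [Nat.mod_eq_of_lt (by omega), uM (r + 1) (by omega), uL r (by omega), f4 r z hz, c2, fL,
            Nat.sub_self, g0]
          exact h z hz
        · by_cases c3 : r + 1 < L + M
          · rw [Nat.mod_eq_of_lt c3, uM _ (by omega), uM _ (by omega), g4 _ z hz]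
            congr 2; omega
          · have c4 : r + 1 = L + M := by omega
            rw [c4, Nat.mod_self, uL 0 hLp, uM _ (by omega), g4 _ z hz, f0]
            have : r - L + 1 = M := by omega
            rw [this, gM]
            exact (h z hz).symm

/-- Perfect factors in the binary de Bruijn graph. -/
theorem perfectFactor (n k : ℕ) (hn : 1 ≤ n) (hkn : k ≤ n) (hnk : n < 2 ^ k) :
    ∃ c : Fin (2 ^ (n - k)) → ℕ → ZMod 2, (∀ q i, c q (i + 2 ^ k) = c q i) ∧
      ∀ q q' i i', (∀ x, x < n → c q (i + x) = c q' (i' + x)) → q = q' ∧ i ≡ i' [MOD 2 ^ k] := by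
  obtain ⟨a, h1, h2⟩ : ∃ a, 2 ^ a ≤ n ∧ n < 2 ^ (a + 1) :=
    ⟨Nat.log 2 n, Nat.pow_log_le_self 2 (by omega), Nat.lt_pow_succ_log_self (by norm_num) n⟩
  have hak : a < k := (Nat.pow_lt_pow_iff_right (a := 2) (by norm_num)).1 (by omega)
  obtain ⟨ι, P, hg, hd, hc⟩ := (main_part n hn a h1 h2).1 (k - (a + 1)) (by omega)
  have hL : 2 ^ (k - (a + 1)) * 2 ^ (a + 1) = 2 ^ k := by rw [← pow_add]; congr 1; omega
  have htr := fun i => (hg i).trail h1 h2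
  rw [hL] at htr
  choose f f1 f2 f3 f4 using htr
  have win : ∀ q i x, x < n → f q (i + x) 0 = f q i x := by
    intro q i x
    induction x generalizing i with
    | zero => intro _; rfl
    | succ x ih =>
      intro hx
      rw [f4 q i x hx, ← ih (i + 1) (by omega)]
      rw [show i + 1 + x = i + (x + 1) by ring]
  have fmem : ∀ q i, f q i ∈ P q := fun q i =>
    (f3 q _).2 ⟨i % 2 ^ k, Nat.mod_lt _ (by positivity), per_mod (f1 q) i⟩
  have inj : ∀ q q' i i', (∀ x, x < n → f q (i + x) 0 = f q' (i' + x) 0) →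
      q = q' ∧ i ≡ i' [MOD 2 ^ k] := by
    intro q q' i i' h
    have e : f q i = f q' i' := by
      refine pref_inj ((hg q).sub (fmem q i)) ((hg q').sub (fmem q' i')) ?_
      intro x hx
      rw [← win q i x hx, ← win q' i' x hx]; exact h x hx
    have : q = q' := hd q q' (f q i) (fmem q i) (e ▸ fmem q' i')
    subst this
    refine ⟨rfl, ?_⟩
    rw [← per_mod (f1 q) i, ← per_mod (f1 q) i'] at e
    exact f2 q _ _ (Nat.mod_lt _ (by positivity)) (Nat.mod_lt _ (by positivity)) e
  -- count
  let Φ : ι × Fin (2 ^ k) → (Fin n → ZMod 2) := fun p x => f p.1 (p.2 + x) 0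
  have hΦ : Function.Bijective Φ := by
    constructor
    · rintro ⟨q, i⟩ ⟨q', i'⟩ h
      obtain ⟨rfl, h'⟩ := inj q q' i i' (fun x hx => congrFun h ⟨x, hx⟩)
      rw [Nat.ModEq, Nat.mod_eq_of_lt i.2, Nat.mod_eq_of_lt i'.2] at h'
      rw [Fin.ext h']
    · intro w
      obtain ⟨x, hx, h⟩ := pref_ex n (fun i => if h : i < n then w ⟨i, h⟩ else 0)
      obtain ⟨q, hq⟩ := hc x hx
      obtain ⟨i, hi, e⟩ := (f3 q x).1 hq
      refine ⟨(q, ⟨i, hi⟩), ?_⟩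
      funext y
      change f q (i + y) 0 = _
      rw [win q i y y.2, e, h y y.2]
      simp
  have card := Nat.card_congr (Equiv.ofBijective Φ hΦ)
  have hcard : Nat.card ι = 2 ^ (n - k) := by
    rw [Nat.card_prod] at card
    simp only [Nat.card_eq_fintype_card (α := Fin n → ZMod 2), Fintype.card_fun, ZMod.card,
      Fintype.card_fin, Nat.card_eq_fintype_card (α := Fin _)] at card
    have e : 2 ^ n = 2 ^ (n - k) * 2 ^ k := by rw [← pow_add]; congr 1; omega
    rw [e] at card
    exact Nat.eq_of_mul_eq_mul_right (by positivity) card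
  have : Finite ι := Nat.finite_of_card_ne_zero (by rw [hcard]; positivity)
  let e := (Finite.equivFin ι).trans (finCongr hcard)
  refine ⟨fun q i => f (e.symm q) i 0, fun q i => by simp only [f1], ?_⟩
  intro q q' i i' h
  obtain ⟨h1, h2⟩ := inj _ _ _ _ h
  exact ⟨e.symm.injective h1, h2⟩

end DBAC

namespace DBAC

lemma digits_ext {B Z Z' w : ℕ} (h0 : Z % B ^ w = Z' % B ^ w) (m : ℕ)
    (h : ∀ g, w ≤ g → g < m → Z / B ^ g % B = Z' / B ^ g % B) (hm : w ≤ m) :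
    Z % B ^ m = Z' % B ^ m := by
  induction m, hm using Nat.le_induction with
  | base => exact h0
  | succ m hm ih =>
    rw [pow_succ, Nat.mod_mul, Nat.mod_mul, ih (fun g h1 h2 => h g h1 (by omega)),
      h m hm (by omega)]

def Yf (δ P J ρ T : ℕ) : ℕ := ρ + δ * ((T / P) % J)

def V (B m δ P J ρ T : ℕ) : ℕ := Yf δ P J ρ T / B ^ (m - 1 - T % m) % B

lemma Yf_lt {δ P J ρ T : ℕ} (hJ : 0 < J) (h : ρ < δ) : Yf δ P J ρ T < δ * J := by
  have : (T / P) % J < J := Nat.mod_lt _ hJ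
  unfold Yf
  calc ρ + δ * ((T / P) % J) < δ + δ * ((T / P) % J) := by omega
    _ = δ * ((T / P) % J + 1) := by ring
    _ ≤ δ * J := Nat.mul_le_mul_left _ this

lemma Yf_inj {δ P J ρ ρ' T T' : ℕ} (h : ρ < δ) (h' : ρ' < δ)
    (hT : T ≡ T' [MOD P]) (he : Yf δ P J ρ T = Yf δ P J ρ' T') :
    ρ = ρ' ∧ T ≡ T' [MOD P * J] := by
  unfold Yf at he
  have h1 : ρ = ρ' := by
    have := congrArg (· % δ) he
    simpa [Nat.mod_eq_of_lt h, Nat.mod_eq_of_lt h'] using this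
  subst h1
  refine ⟨rfl, ?_⟩
  have h2 : (T / P) % J = (T' / P) % J := Nat.eq_of_mul_eq_mul_left (by omega) (Nat.add_left_cancel he)
  unfold Nat.ModEq at *
  rw [Nat.mod_mul, Nat.mod_mul, hT, h2]

lemma digitLemma {B K m δ P J ρ ρ' T T' : ℕ} (hm : 0 < m) (hP : 0 < P)
    (hJ : 0 < J) (hKB : K ∣ B) (hK : 0 < K) (hB : 0 < B) (hmP : m ∣ P)
    (hN : B ^ (m - 1) * K = δ * J) (h : ρ < δ) (h' : ρ' < δ) (hT : T ≡ T' [MOD P])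
    (hV : ∀ y, y < m → V B m δ P J ρ (T + y) = V B m δ P J ρ' (T' + y)) :
    ρ = ρ' ∧ T ≡ T' [MOD P * J] := by
  have hTm : T % m = T' % m := hT.of_dvd hmP
  have hp : T % m < m := Nat.mod_lt _ hm
  have hle : δ * J ≤ B ^ m := by
    rw [← hN]
    calc B ^ (m - 1) * K ≤ B ^ (m - 1) * B := Nat.mul_le_mul_left _ (Nat.le_of_dvd hB hKB)
      _ = B ^ m := by rw [← pow_succ]; congr 1; omega
  have fin : ∀ T1 T1', T1 ≡ T1' [MOD P] → Yf δ P J ρ T1 % B ^ m = Yf δ P J ρ' T1' % B ^ m →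
      ρ = ρ' ∧ T1 ≡ T1' [MOD P * J] := by
    intro T1 T1' h1 h2
    rw [Nat.mod_eq_of_lt (lt_of_lt_of_le (Yf_lt hJ h) hle),
      Nat.mod_eq_of_lt (lt_of_lt_of_le (Yf_lt hJ h') hle)] at h2
    exact Yf_inj h h' h1 h2
  have hs : T % P < P := Nat.mod_lt _ hP
  have eT : T = P * (T / P) + T % P := (Nat.div_add_mod T P).symm
  have eT' : T' = P * (T' / P) + T % P := by rw [hT]; exact (Nat.div_add_mod T' P).symm
  have hsm : T % P % m = T % m := Nat.mod_mod_of_dvd T hmP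
  set s := T % P with hsdef
  set α := T / P with hα
  set α' := T' / P with hα'
  have blk : ∀ (β y : ℕ), s + y < P → (P * β + s + y) / P = β := by
    intro β y hy
    rw [add_assoc, Nat.mul_add_div hP, Nat.div_eq_of_lt hy, add_zero]
  have blk' : ∀ (β y : ℕ), P ≤ s + y → s + y < P + P → (P * β + s + y) / P = β + 1 := by
    intro β y hy hy'
    rw [add_assoc, Nat.mul_add_div hP]
    congr 1
    rw [Nat.div_eq_iff hP]
    omega
  have Yeq : ∀ ρ T T', T / P = T' / P → Yf δ P J ρ T = Yf δ P J ρ T' := by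
    intro ρ T T' h; unfold Yf; rw [h]
  by_cases hc : s + m ≤ P
  · apply fin T T' hT
    refine digits_ext (w := 0) (by simp [Nat.mod_one]) m ?_ (by omega)
    intro g _ hg
    -- find y with (T + y) % m = m - 1 - g
    obtain ⟨y, hy, hy2⟩ : ∃ y, y < m ∧ (T + y) % m = m - 1 - g := by
      by_cases hh : T % m ≤ m - 1 - g
      · refine ⟨m - 1 - g - T % m, by omega, ?_⟩
        rw [Nat.add_mod, Nat.mod_eq_of_lt (show m - 1 - g - T % m < m by omega),
          Nat.mod_eq_of_lt (by omega)]
        omega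
      · refine ⟨m - 1 - g + m - T % m, by omega, ?_⟩
        rw [Nat.add_mod, Nat.mod_eq_of_lt (show m - 1 - g + m - T % m < m by omega),
          show T % m + (m - 1 - g + m - T % m) = m - 1 - g + m by omega,
          Nat.add_mod_right, Nat.mod_eq_of_lt (by omega)]
    have hy2' : (T' + y) % m = m - 1 - g := by rw [Nat.add_mod, ← hTm, ← Nat.add_mod, hy2]
    have := hV y hy
    unfold V at this
    rw [hy2, hy2', show m - 1 - (m - 1 - g) = g by omega] at this
    rw [Yeq ρ (T + y) T (by rw [eT, blk _ _ (by omega)]; simpa using (blk α 0 (by omega)).symm),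
      Yeq ρ' (T' + y) T' (by rw [eT', blk _ _ (by omega)]; simpa using (blk α' 0 (by omega)).symm)] at this
    exact this
  · -- wrap case
    have hsp : s + (m - T % m) = P := by
      obtain ⟨u, hu⟩ := hmP
      have e1 : s = m * (s / m) + T % m := by rw [← hsm]; exact (Nat.div_add_mod s m).symm
      have h1 : s / m < u := by
        by_contra hcon
        have := Nat.mul_le_mul_left m (Nat.not_lt.1 hcon)
        omega
      have h2 : u < s / m + 2 := by
        by_contra hcon
        have := Nat.mul_le_mul_left m (Nat.not_lt.1 hcon)
        rw [Nat.mul_add] at this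
        omega
      have h3 : u = s / m + 1 := by omega
      rw [h3, Nat.mul_add] at hu
      omega
    set p := T % m with hpdef
    have hp0 : 0 < p := by omega
    suffices hh : ρ = ρ' ∧ T + (m - p) ≡ T' + (m - p) [MOD P * J] from
      ⟨hh.1, Nat.ModEq.add_right_cancel' _ hh.2⟩
    apply fin _ _ (hT.add_right _)
    -- low digits
    have low : Yf δ P J ρ T % B ^ (m - p) = Yf δ P J ρ' T' % B ^ (m - p) := by
      refine digits_ext (w := 0) (by simp [Nat.mod_one]) (m - p) ?_ (by omega)
      intro g _ hg
      have hy2 : (T + (m - 1 - g - p)) % m = m - 1 - g := by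
        rw [Nat.add_mod, ← hpdef, Nat.mod_eq_of_lt (show m - 1 - g - p < m by omega),
          Nat.mod_eq_of_lt (by omega)]
        omega
      have hy2' : (T' + (m - 1 - g - p)) % m = m - 1 - g := by
        rw [Nat.add_mod, ← hTm, hpdef, ← Nat.add_mod, hy2]
      have := hV (m - 1 - g - p) (by omega)
      unfold V at this
      rw [hy2, hy2', show m - 1 - (m - 1 - g) = g by omega] at this
      rw [Yeq ρ (T + _) T (by rw [eT, blk _ _ (by omega)]; simpa using (blk α 0 (by omega)).symm),
        Yeq ρ' (T' + _) T' (by rw [eT', blk _ _ (by omega)]; simpa using (blk α' 0 (by omega)).symm)] at this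
      exact this
    have hdvd : B ^ (m - p) ∣ δ * J := by
      rw [← hN]
      exact Dvd.dvd.mul_right (pow_dvd_pow B (by omega)) K
    have cong : ∀ ρ β, Yf δ P J ρ (P * β + s + (m - p)) ≡ Yf δ P J ρ (P * β + s) + δ
        [MOD B ^ (m - p)] := by
      intro ρ β
      refine Nat.ModEq.of_dvd hdvd ?_
      unfold Yf
      rw [blk' β (m - p) (by omega) (by omega)]
      have : (P * β + s) / P = β := by simpa using blk β 0 (by omega)
      rw [this, add_assoc]
      apply Nat.ModEq.add_left
      rw [show δ * (β % J) + δ = δ * (β % J + 1) by ring]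
      apply Nat.ModEq.mul_left'
      exact (Nat.mod_modEq _ _).trans ((Nat.mod_modEq β J).symm.add_right 1)
    refine digits_ext (w := m - p) ?_ m ?_ (by omega)
    · have c1 := cong ρ α
      have c2 := cong ρ' α'
      rw [← eT] at c1
      rw [← eT'] at c2
      exact c1.trans ((Nat.ModEq.add_right δ low).trans c2.symm)
    · intro g hg1 hg2
      have hy2 : (T + (m - 1 - g + m - p)) % m = m - 1 - g := by
        rw [Nat.add_mod, ← hpdef, Nat.mod_eq_of_lt (show m - 1 - g + m - p < m by omega),
          show p + (m - 1 - g + m - p) = m - 1 - g + m by omega, Nat.add_mod_right,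
          Nat.mod_eq_of_lt (by omega)]
      have hy2' : (T' + (m - 1 - g + m - p)) % m = m - 1 - g := by
        rw [Nat.add_mod, ← hTm, hpdef, ← Nat.add_mod, hy2]
      have := hV (m - 1 - g + m - p) (by omega)
      unfold V at this
      rw [hy2, hy2', show m - 1 - (m - 1 - g) = g by omega] at this
      have hmP' : m ≤ P := Nat.le_of_dvd hP hmP
      rw [Yeq ρ (T + _) (T + (m - p)) (by
            rw [eT, blk' _ _ (by omega) (by omega), blk' _ _ (by omega) (by omega)]),
        Yeq ρ' (T' + _) (T' + (m - p)) (by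
            rw [eT', blk' _ _ (by omega) (by omega), blk' _ _ (by omega) (by omega)])] at this
      exact this

/-- natural number indexed version -/
theorem perfectFactorNat (n k : ℕ) (hn : 1 ≤ n) (hkn : k ≤ n) (hnk : n < 2 ^ k) :
    ∃ c : ℕ → ℕ → ZMod 2, (∀ q i, c q (i + 2 ^ k) = c q i) ∧
      ∀ q q' i i', q < 2 ^ (n - k) → q' < 2 ^ (n - k) →
        (∀ x, x < n → c q (i + x) = c q' (i' + x)) → q = q' ∧ i ≡ i' [MOD 2 ^ k] := by
  obtain ⟨c, h1, h2⟩ := perfectFactor n k hn hkn hnk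
  refine ⟨fun q => if h : q < 2 ^ (n - k) then c ⟨q, h⟩ else 0, ?_, ?_⟩
  · intro q i
    by_cases h : q < 2 ^ (n - k)
    · simp only [dif_pos h]; exact h1 _ _
    · simp only [dif_neg h]; rfl
  · intro q q' i i' hq hq' h
    simp only [dif_pos hq, dif_pos hq'] at h
    obtain ⟨h3, h4⟩ := h2 _ _ _ _ h
    exact ⟨congrArg Fin.val h3, h4⟩

end DBAC

open DBAC

theorem stmt_17 (t k l n : ℕ) (hkn : k < n) (hn : n < 2 ^ k) (hl : 1 ≤ l)
    (htl : l + 1 ≤ t) (htn : t ≤ n * 2 ^ l - k) :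
    ∃ C : Fin (2 ^ (n * 2 ^ l - k - t)) → (ZMod (2 ^ k) × ZMod (2 ^ t) → ZMod 2),
      IsDBAC (2 ^ k) (2 ^ t) n (2 ^ l) (2 ^ (n * 2 ^ l - k - t)) C := by
  obtain ⟨c, cper, cinj⟩ := perfectFactorNat n k (by omega) (by omega) hn
  have hm0 : 0 < 2 ^ l := by positivity
  have hlm : l + 1 ≤ 2 ^ l := Nat.lt_two_pow_self
  obtain ⟨t', j, ht'l, ht'm, htj, hor⟩ : ∃ t' j, l + 1 ≤ t' ∧ t' ≤ 2 ^ l ∧ t' + j = t ∧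
      (j = 0 ∨ t' = 2 ^ l) := by
    by_cases h : t ≤ 2 ^ l
    · exact ⟨t, 0, htl, h, rfl, Or.inl rfl⟩
    · exact ⟨2 ^ l, t - 2 ^ l, hlm, le_rfl, by omega, Or.inr rfl⟩
  have hmt' : 2 ^ l < 2 ^ t' := Nat.pow_lt_pow_right (by norm_num) (by omega)
  obtain ⟨d, dper, dinj⟩ := perfectFactorNat (2 ^ l) t' hm0 ht'm hmt'
  have hmP : 2 ^ l ∣ 2 ^ t' := pow_dvd_pow 2 (by omega)
  obtain ⟨n', rfl⟩ : ∃ n', n = n' + 1 := ⟨n - 1, by omega⟩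
  obtain ⟨u, rfl⟩ : ∃ u, n' = k + u := ⟨n' - k, by omega⟩
  -- the total digit size
  obtain ⟨N, hNdef⟩ : ∃ N, N = (k + u) * (2 ^ l - 1) + u := ⟨_, rfl⟩
  have hnm : (k + u + 1) * 2 ^ l = N + k + 2 ^ l := by
    obtain ⟨m, hm⟩ : ∃ m, 2 ^ l = m + 1 := ⟨2 ^ l - 1, by omega⟩
    rw [hNdef, hm, Nat.add_sub_cancel]; ring
  have hjN : j ≤ N := by
    rcases hor with h | h <;> omega
  have hΔ : (k + u + 1) * 2 ^ l - k - t = (2 ^ l - t') + (N - j) := by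
    rcases hor with h | h <;> omega
  have hB : 2 ^ (k + u) = 2 ^ u * 2 ^ k := by rw [← pow_add]; congr 1; omega
  have hQ : 2 ^ (k + u + 1 - k) = 2 ^ u + 2 ^ u := by
    rw [show k + u + 1 - k = u + 1 by omega]; ring
  have hN : (2 ^ (k + u)) ^ (2 ^ l - 1) * 2 ^ u = 2 ^ (N - j) * 2 ^ j := by
    rw [← pow_mul, ← pow_add, ← pow_add, hNdef, Nat.sub_add_cancel (by omega)]
  have hPJ : 2 ^ t' * 2 ^ j = 2 ^ t := by rw [← pow_add, htj]
  have hKpos : 0 < 2 ^ u := by positivity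
  let W : ℕ → ℕ → ℕ := V (2 ^ (k + u)) (2 ^ l) (2 ^ (N - j)) (2 ^ t') (2 ^ j)
  have Wlt : ∀ ρ T, W ρ T < 2 ^ u * 2 ^ k := by
    intro ρ T
    rw [← hB]
    exact Nat.mod_lt _ (by positivity)
  let G : ℕ → ℕ → ℕ → ℕ → ZMod 2 := fun r ρ i T =>
    c ((d r T).val * 2 ^ u + W ρ T % 2 ^ u) (i + W ρ T / 2 ^ u)
  have idx_lt : ∀ (b : ZMod 2) (v : ℕ), b.val * 2 ^ u + v % 2 ^ u < 2 ^ (k + u + 1 - k) := by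
    intro b v
    rw [hQ]
    have h1 : b.val < 2 := ZMod.val_lt b
    have h2 := Nat.mod_lt v hKpos
    have h3 : b.val * 2 ^ u ≤ 1 * 2 ^ u := Nat.mul_le_mul_right _ (by omega)
    omega
  have cper' : ∀ q i, c q (i % 2 ^ k) = c q i := fun q i => per_mod (cper q) i
  have cmod : ∀ q i i', i ≡ i' [MOD 2 ^ k] → c q i = c q i' := by
    intro q i i' h
    rw [← cper' q i, ← cper' q i', h]
  have dmod : ∀ q i i', i ≡ i' [MOD 2 ^ t'] → d q i = d q i' := by
    intro q i i' h
    rw [← per_mod (dper q) i, ← per_mod (dper q) i', h]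
  have Wmod : ∀ ρ T T', T ≡ T' [MOD 2 ^ t] → W ρ T = W ρ T' := by
    intro ρ T T' h
    have h1 : T % 2 ^ l = T' % 2 ^ l := h.of_dvd (pow_dvd_pow 2 (by omega))
    have h2 : T / 2 ^ t' % 2 ^ j = T' / 2 ^ t' % 2 ^ j := by
      rw [← Nat.mod_mul_right_div_self, ← Nat.mod_mul_right_div_self, hPJ, h]
    simp only [W, V, Yf, h1, h2]
  have Gmod : ∀ r ρ i i' T T', i ≡ i' [MOD 2 ^ k] → T ≡ T' [MOD 2 ^ t] →
      G r ρ i T = G r ρ i' T' := by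
    intro r ρ i i' T T' h1 h2
    simp only [G]
    rw [Wmod ρ T T' h2, dmod r T T' (h2.of_dvd (pow_dvd_pow 2 (by omega)))]
    exact cmod _ _ _ (h1.add_right _)
  -- main injectivity
  have Ginj : ∀ r r' ρ ρ' i i' T T', r < 2 ^ (2 ^ l - t') → r' < 2 ^ (2 ^ l - t') →
      ρ < 2 ^ (N - j) → ρ' < 2 ^ (N - j) →
      (∀ x y, x < k + u + 1 → y < 2 ^ l → G r ρ (i + x) (T + y) = G r' ρ' (i' + x) (T' + y)) →
      r = r' ∧ ρ = ρ' ∧ i ≡ i' [MOD 2 ^ k] ∧ T ≡ T' [MOD 2 ^ t] := by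
    intro r r' ρ ρ' i i' T T' hr hr' hρ hρ' h
    have h1 : ∀ y, y < 2 ^ l → d r (T + y) = d r' (T' + y) ∧
        W ρ (T + y) % 2 ^ u = W ρ' (T' + y) % 2 ^ u ∧
        i + W ρ (T + y) / 2 ^ u ≡ i' + W ρ' (T' + y) / 2 ^ u [MOD 2 ^ k] := by
      intro y hy
      obtain ⟨e1, e2⟩ := cinj _ _ (i + W ρ (T + y) / 2 ^ u) (i' + W ρ' (T' + y) / 2 ^ u)
        (idx_lt (d r (T + y)) (W ρ (T + y))) (idx_lt (d r' (T' + y)) (W ρ' (T' + y))) (by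
          intro x hx
          have := h x y hx hy
          simp only [G] at this
          rw [add_right_comm i, add_right_comm i']
          exact this)
      refine ⟨?_, ?_, e2⟩
      · have := congrArg (· / 2 ^ u) e1
        simp only [mul_comm _ (2 ^ u), Nat.mul_add_div hKpos,
          Nat.div_eq_of_lt (Nat.mod_lt _ hKpos), add_zero] at this
        exact ZMod.val_injective 2 this
      · have := congrArg (· % 2 ^ u) e1
        simpa [mul_comm _ (2 ^ u)] using this
    obtain ⟨hrr, hTT⟩ := dinj r r' T T' hr hr' (fun y hy => (h1 y hy).1)
    have hTm : T ≡ T' [MOD 2 ^ l] := hTT.of_dvd hmP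
    -- the column of coordinate zero
    have zero : ∀ ρ T, ρ < 2 ^ (N - j) → T % 2 ^ l = 0 → W ρ T / 2 ^ u = 0 := by
      intro ρ T hρ hT
      apply Nat.div_eq_of_lt
      simp only [W, V, hT]
      refine lt_of_le_of_lt (Nat.mod_le _ _) ?_
      rw [Nat.sub_zero, Nat.div_lt_iff_lt_mul (by positivity), mul_comm, hN]
      exact Yf_lt (by positivity) hρ
    have hii : i ≡ i' [MOD 2 ^ k] := by
      obtain ⟨y, hy, hy0⟩ : ∃ y, y < 2 ^ l ∧ (T + y) % 2 ^ l = 0 := by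
        have hp := Nat.mod_lt T hm0
        by_cases hz : T % 2 ^ l = 0
        · exact ⟨0, hm0, by simpa using hz⟩
        · refine ⟨2 ^ l - T % 2 ^ l, by omega, ?_⟩
          rw [← Nat.mod_add_mod, Nat.add_sub_cancel' hp.le, Nat.mod_self]
      have hy0' : (T' + y) % 2 ^ l = 0 := by rw [← hTm.add_right y]; exact hy0
      have := (h1 y hy).2.2
      rwa [zero ρ _ hρ hy0, zero ρ' _ hρ' hy0', add_zero, add_zero] at this
    have hW : ∀ y, y < 2 ^ l → W ρ (T + y) = W ρ' (T' + y) := by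
      intro y hy
      obtain ⟨_, e1, e2⟩ := h1 y hy
      have e3 : W ρ (T + y) / 2 ^ u ≡ W ρ' (T' + y) / 2 ^ u [MOD 2 ^ k] :=
        Nat.ModEq.add_left_cancel hii e2
      have l1 : ∀ ρ T, W ρ T / 2 ^ u < 2 ^ k := fun ρ T =>
        Nat.div_lt_of_lt_mul (Wlt ρ T)
      have e4 := e3
      rw [Nat.ModEq, Nat.mod_eq_of_lt (l1 _ _), Nat.mod_eq_of_lt (l1 _ _)] at e4
      rw [← Nat.div_add_mod (W ρ (T + y)) (2 ^ u), e1, e4, Nat.div_add_mod]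
    obtain ⟨e1, e2⟩ := digitLemma (B := 2 ^ (k + u)) (K := 2 ^ u) (m := 2 ^ l) (δ := 2 ^ (N - j))
      (P := 2 ^ t') (J := 2 ^ j) hm0 (by positivity) (by positivity)
      (pow_dvd_pow 2 (by omega)) hKpos (by positivity) hmP hN hρ hρ' hTT hW
    rw [hPJ] at e2
    exact ⟨hrr, e1, hii, e2⟩
  -- assemble
  have hcardF : 2 ^ ((k + u + 1) * 2 ^ l - k - t) = 2 ^ (2 ^ l - t') * 2 ^ (N - j) := by
    rw [hΔ, pow_add]
  let e : Fin (2 ^ ((k + u + 1) * 2 ^ l - k - t)) ≃ Fin (2 ^ (2 ^ l - t')) × Fin (2 ^ (N - j)) :=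
    (finCongr hcardF).trans finProdFinEquiv.symm
  have : NeZero (2 ^ k) := ⟨by positivity⟩
  have : NeZero (2 ^ t) := ⟨by positivity⟩
  let C : Fin (2 ^ ((k + u + 1) * 2 ^ l - k - t)) → (ZMod (2 ^ k) × ZMod (2 ^ t) → ZMod 2) :=
    fun f p => G (e f).1 (e f).2 p.1.val p.2.val
  refine ⟨C, ?_⟩
  let Ψ : Fin (2 ^ ((k + u + 1) * 2 ^ l - k - t)) × ZMod (2 ^ k) × ZMod (2 ^ t) →
      (Fin (k + u + 1) → Fin (2 ^ l) → ZMod 2) :=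
    fun p x y => C p.1 (p.2.1 + (x : ℕ), p.2.2 + (y : ℕ))
  have valadd : ∀ (M : ℕ) [NeZero M] (z : ZMod M) (x : ℕ), (z + (x : ZMod M)).val ≡ z.val + x [MOD M] := by
    intro M _ z x
    rw [← ZMod.natCast_eq_natCast_iff]
    simp
  have Ψeq : ∀ p x y, Ψ p x y = G (e p.1).1 (e p.1).2 (p.2.1.val + x) (p.2.2.val + y) := by
    intro p x y
    exact Gmod _ _ _ _ _ _ (valadd _ _ _) (valadd _ _ _)
  have Ψinj : Function.Injective Ψ := by
    rintro ⟨f, a, b⟩ ⟨f', a', b'⟩ h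
    obtain ⟨h1, h2, h3, h4⟩ := Ginj _ _ _ _ a.val a'.val b.val b'.val (e f).1.2 (e f').1.2
      (e f).2.2 (e f').2.2 (by
        intro x y hx hy
        have := congrFun (congrFun h ⟨x, hx⟩) ⟨y, hy⟩
        rw [Ψeq, Ψeq] at this
        exact this)
    have hf : f = f' := e.injective (Prod.ext (Fin.ext h1) (Fin.ext h2))
    have ha : a = a' := by
      rw [← ZMod.natCast_eq_natCast_iff] at h3
      simpa using h3
    have hb : b = b' := by
      rw [← ZMod.natCast_eq_natCast_iff] at h4
      simpa using h4
    rw [hf, ha, hb]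
  have Ψbij : Function.Bijective Ψ := by
    rw [Fintype.bijective_iff_injective_and_card]
    refine ⟨Ψinj, ?_⟩
    simp only [Fintype.card_prod, Fintype.card_fin, ZMod.card, Fintype.card_fun]
    rw [← pow_mul, ← pow_add, ← pow_add]
    congr 1
    rw [mul_comm (2 ^ l)]
    omega
  intro M
  obtain ⟨p, hp, huniq⟩ := Ψbij.existsUnique M
  refine ⟨p, fun x y => congrFun (congrFun hp x) y, ?_⟩
  intro q hq
  exact huniq q (funext fun x => funext fun y => hq x y)
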